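/- Let f : ℝ^n → ℝ be continuously differentiable with L-Lipschitz gradient, let Q be a real n×d' matrix, ε > 0, εc ∈ (0,1), C > 0, and x ∈ ℝ^n. Assume: ‖Qᵀ∇f(x)‖² ≥ (1−εc) d' ‖∇f(x)‖², ‖Q‖_op² ≤ C n, (1−εc) d' ≤ C n, and ‖Qᵀ∇f(x)‖ ≥ 4 d' ‖Q‖_op² L ε. Let P be a real n×m matrix one of whose columns equals Q∇_{Q,ε}f(x)/‖Q∇_{Q,ε}f(x)‖, where ∇_{Q,ε}f(x) is the finite-difference subspace gradient. Then ‖Pᵀ∇f(x)‖ ≥ ((1−εc) d' / (3 C n)) ‖∇f(x)‖. -/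

import Mathlib

open Matrix

/-- The operator norm of a matrix acting between Euclidean spaces. -/
noncomputable def matOpNorm {n m : ℕ} (A : Matrix (Fin n) (Fin m) ℝ) : ℝ :=
  ‖LinearMap.toContinuousLinearMap (Matrix.toEuclideanLin A)‖

/-- The finite-difference subspace gradient: `(∇_{Q,ε}f(x))_i = (f(x+εQe_i) - f(x-εQe_i))/(2ε)`. -/
noncomputable def fdGrad {n d' : ℕ} (f : EuclideanSpace ℝ (Fin n) → ℝ)
    (Q : Matrix (Fin n) (Fin d') ℝ) (ε : ℝ) (x : EuclideanSpace ℝ (Fin n)) :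
    EuclideanSpace ℝ (Fin d') :=
  (EuclideanSpace.equiv (Fin d') ℝ).symm fun i =>
    (f (x + ε • Matrix.toEuclideanLin Q (EuclideanSpace.single i (1 : ℝ))) -
      f (x - ε • Matrix.toEuclideanLin Q (EuclideanSpace.single i (1 : ℝ)))) / (2 * ε)

/-- If `f` has an `L`-Lipschitz gradient, the error of the symmetric difference of `f` along `w`
against its linearization is at most `2 L ‖w‖²`. -/
lemma abs_symm_diff_sub_inner_gradient_le {E : Type*} [NormedAddCommGroup E]
    [InnerProductSpace ℝ E] [CompleteSpace E] {f : E → ℝ} {L : ℝ} (hL : 0 ≤ L)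
    (hf : Differentiable ℝ f)
    (hlip : ∀ u v : E, ‖gradient f u - gradient f v‖ ≤ L * ‖u - v‖) (x w : E) :
    |f (x + w) - f (x - w) - 2 * inner ℝ (gradient f x) w| ≤ 2 * L * ‖w‖ ^ 2 := by
  have hbound : ∀ y ∈ Metric.closedBall x ‖w‖,
      ‖InnerProductSpace.toDual ℝ E (gradient f y) -
        InnerProductSpace.toDual ℝ E (gradient f x)‖ ≤ L * ‖w‖ := by
    intro y hy
    rw [← map_sub, LinearIsometryEquiv.norm_map]
    rw [mem_closedBall_iff_norm] at hy
    exact (hlip y x).trans (by gcongr)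
  have h := (convex_closedBall x ‖w‖).norm_image_sub_le_of_norm_hasFDerivWithin_le'
    (fun y _ => (hf y).hasGradientAt.hasFDerivAt.hasFDerivWithinAt) hbound
    (x := x - w) (y := x + w) (by simp)
    (by simp)
  have hw : x + w - (x - w) = (2 : ℝ) • w := by
    rw [two_smul]
    abel
  rw [hw, InnerProductSpace.toDual_apply_apply, inner_smul_right, norm_smul,
    Real.norm_eq_abs, Real.norm_eq_abs] at h
  rw [abs_of_pos (two_pos : (0 : ℝ) < 2)] at h
  linarith

lemma norm_toEuclideanLin_le {n m : ℕ} (A : Matrix (Fin n) (Fin m) ℝ)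
    (v : EuclideanSpace ℝ (Fin m)) : ‖Matrix.toEuclideanLin A v‖ ≤ matOpNorm A * ‖v‖ :=
  (LinearMap.toContinuousLinearMap (Matrix.toEuclideanLin A)).le_opNorm v

lemma inner_toEuclideanLin_transpose {n m : ℕ} (A : Matrix (Fin n) (Fin m) ℝ)
    (v : EuclideanSpace ℝ (Fin m)) (g : EuclideanSpace ℝ (Fin n)) :
    inner ℝ (Matrix.toEuclideanLin Aᵀ g) v = inner ℝ g (Matrix.toEuclideanLin A v) := by
  rw [← Matrix.conjTranspose_eq_transpose_of_trivial, Matrix.toEuclideanLin_conjTranspose_eq_adjoint,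
    LinearMap.adjoint_inner_left]

lemma EuclideanSpace.norm_le_card_mul {d : ℕ} (v : EuclideanSpace ℝ (Fin d)) {c : ℝ}
    (hv : ∀ i, |v i| ≤ c) : ‖v‖ ≤ d * c := by
  calc ‖v‖ = ‖∑ i, EuclideanSpace.single i (v i)‖ := by
        congr 1
        ext j
        simp [Finset.sum_apply]
    _ ≤ ∑ i, ‖EuclideanSpace.single i (v i)‖ := norm_sum_le _ _
    _ ≤ ∑ _i : Fin d, c := by
        gcongr with i
        simpa using hv i
    _ = d * c := by simp

/-- The finite-difference subspace gradient approximates `Qᵀ∇f(x)`. -/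
lemma norm_fdGrad_sub_le {n d' : ℕ} {f : EuclideanSpace ℝ (Fin n) → ℝ} {L : ℝ} (hL : 0 ≤ L)
    (hf : Differentiable ℝ f)
    (hlip : ∀ u v : EuclideanSpace ℝ (Fin n), ‖gradient f u - gradient f v‖ ≤ L * ‖u - v‖)
    (Q : Matrix (Fin n) (Fin d') ℝ) {ε : ℝ} (hε : 0 < ε) (x : EuclideanSpace ℝ (Fin n)) :
    ‖fdGrad f Q ε x - Matrix.toEuclideanLin Qᵀ (gradient f x)‖ ≤
      d' * (matOpNorm Q ^ 2 * L * ε) := by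
  refine EuclideanSpace.norm_le_card_mul _ fun i => ?_
  set w := Matrix.toEuclideanLin Q (EuclideanSpace.single i (1 : ℝ)) with hw
  have hcomp : Matrix.toEuclideanLin Qᵀ (gradient f x) i = inner ℝ (gradient f x) w := by
    rw [hw, ← inner_toEuclideanLin_transpose, EuclideanSpace.inner_single_right]
    simp
  have hwn : ‖w‖ ≤ matOpNorm Q := by
    simpa using norm_toEuclideanLin_le Q (EuclideanSpace.single i (1 : ℝ))
  have h := abs_symm_diff_sub_inner_gradient_le hL hf hlip x (ε • w)
  rw [inner_smul_right, norm_smul, Real.norm_of_nonneg hε.le] at h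
  have hfd : (fdGrad f Q ε x - Matrix.toEuclideanLin Qᵀ (gradient f x)) i =
      (f (x + ε • w) - f (x - ε • w) - 2 * (ε * inner ℝ (gradient f x) w)) / (2 * ε) := by
    rw [PiLp.sub_apply, hcomp]
    change (f (x + ε • w) - f (x - ε • w)) / (2 * ε) - _ = _
    field_simp
  rw [hfd, abs_div, abs_of_pos (by positivity : 0 < 2 * ε), div_le_iff₀ (by positivity)]
  calc _ ≤ 2 * L * (ε * ‖w‖) ^ 2 := h
    _ ≤ 2 * L * (ε * matOpNorm Q) ^ 2 := by gcongr
    _ = _ := by ring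

/-- Let `f` be continuously differentiable with `L`-Lipschitz gradient, `ε > 0`, `εc ∈ (0,1)`,
`C > 0`. If `‖Qᵀ∇f(x)‖² ≥ (1-εc) d' ‖∇f(x)‖²`, `‖Q‖_op² ≤ C n`, `(1-εc) d' ≤ C n`,
`‖Qᵀ∇f(x)‖ ≥ 4 d' ‖Q‖_op² L ε`, and `P` has a column `Q∇_{Q,ε}f(x)/‖Q∇_{Q,ε}f(x)‖`, then
`‖Pᵀ∇f(x)‖ ≥ ((1-εc) d' / (3 C n)) ‖∇f(x)‖`. -/
theorem stmt13 {n m d' : ℕ} (f : EuclideanSpace ℝ (Fin n) → ℝ)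
    (L : ℝ) (hL : 0 < L) (hf : ContDiff ℝ 1 f)
    (hlip : ∀ u v : EuclideanSpace ℝ (Fin n),
      ‖gradient f u - gradient f v‖ ≤ L * ‖u - v‖)
    (Q : Matrix (Fin n) (Fin d') ℝ) (ε : ℝ) (hε : 0 < ε)
    (εc : ℝ) (hεc : εc ∈ Set.Ioo (0 : ℝ) 1) (C : ℝ) (hC : 0 < C)
    (x : EuclideanSpace ℝ (Fin n))
    (hlow : (1 - εc) * d' * ‖gradient f x‖ ^ 2 ≤
      ‖Matrix.toEuclideanLin Qᵀ (gradient f x)‖ ^ 2)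
    (hop : matOpNorm Q ^ 2 ≤ C * n)
    (hdim : (1 - εc) * d' ≤ C * n)
    (hbig : 4 * d' * matOpNorm Q ^ 2 * L * ε ≤
      ‖Matrix.toEuclideanLin Qᵀ (gradient f x)‖)
    (P : Matrix (Fin n) (Fin m) ℝ)
    (hcol : ∃ j : Fin m,
      Matrix.toEuclideanLin P (EuclideanSpace.single j (1 : ℝ)) =
        ‖Matrix.toEuclideanLin Q (fdGrad f Q ε x)‖⁻¹ •
          Matrix.toEuclideanLin Q (fdGrad f Q ε x)) :
    (1 - εc) * d' / (3 * C * n) * ‖gradient f x‖ ≤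
      ‖Matrix.toEuclideanLin Pᵀ (gradient f x)‖ := by
  have hfd := norm_fdGrad_sub_le hL.le (hf.differentiable one_ne_zero) hlip Q hε x
  obtain ⟨j, hj⟩ := hcol
  set g := gradient f x
  set a := Matrix.toEuclideanLin Qᵀ g with ha
  set h := fdGrad f Q ε x
  set y := Matrix.toEuclideanLin Q h with hy
  set q := matOpNorm Q
  set D := (1 - εc) * (d' : ℝ)
  set K := C * (n : ℝ) with hK
  have hD0 : 0 ≤ D := mul_nonneg (by linarith [hεc.2]) (Nat.cast_nonneg _)
  have hK0 : 0 ≤ K := by positivity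
  rw [show 3 * C * (n : ℝ) = 3 * K by rw [hK]; ring]
  have hs0 : 0 ≤ ‖Matrix.toEuclideanLin Pᵀ g‖ := norm_nonneg _
  rcases hK0.eq_or_lt with hK00 | hKpos
  · simp [← hK00]
  have hle : ‖h - a‖ ≤ ‖a‖ / 4 := by linarith
  rcases (norm_nonneg a).eq_or_lt with ha0 | hapos
  · have hDg : D * ‖g‖ = 0 := by
      rw [← ha0] at hlow
      have : D * ‖g‖ ^ 2 = 0 := le_antisymm (by simpa using hlow) (by positivity)
      simpa using this
    rw [div_mul_eq_mul_div, hDg, zero_div]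
    exact hs0
  have hah : 3 / 4 * ‖a‖ ^ 2 ≤ inner ℝ a h := by
    have h1 : inner ℝ a h = ‖a‖ ^ 2 + inner ℝ a (h - a) := by
      rw [inner_sub_right, real_inner_self_eq_norm_sq]
      ring
    have h2 := neg_le_of_abs_le (abs_real_inner_le_norm a (h - a))
    nlinarith
  have hhn : ‖h‖ ≤ 5 / 4 * ‖a‖ := by
    have := norm_le_norm_add_norm_sub' h a
    linarith
  have hq0 : 0 ≤ q := norm_nonneg _
  have hyn : ‖y‖ ≤ q * (5 / 4 * ‖a‖) := (norm_toEuclideanLin_le Q h).trans (by gcongr)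
  rw [ha, inner_toEuclideanLin_transpose, ← ha, ← hy] at hah
  have hy0 : 0 < ‖y‖ := by
    rw [norm_pos_iff]
    intro h0
    rw [h0, inner_zero_right] at hah
    nlinarith
  have hcs : ‖y‖⁻¹ * inner ℝ g y ≤ ‖Matrix.toEuclideanLin Pᵀ g‖ := by
    rw [← real_inner_smul_right, ← hj, ← inner_toEuclideanLin_transpose]
    simpa using real_inner_le_norm (Matrix.toEuclideanLin Pᵀ g) (EuclideanSpace.single j (1 : ℝ))
  rw [inv_mul_le_iff₀ hy0] at hcs
  set s := ‖Matrix.toEuclideanLin Pᵀ g‖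
  have hsq : 3 / 5 * ‖a‖ ≤ s * q := by
    have : ‖y‖ * s ≤ q * (5 / 4 * ‖a‖) * s := by gcongr
    nlinarith
  have hmain : 9 / 25 * (D * ‖g‖ ^ 2) ≤ s ^ 2 * K :=
    calc 9 / 25 * (D * ‖g‖ ^ 2) ≤ (3 / 5 * ‖a‖) ^ 2 := by linarith
      _ ≤ (s * q) ^ 2 := by gcongr
      _ = s ^ 2 * q ^ 2 := by ring
      _ ≤ s ^ 2 * K := by gcongr
  rw [div_mul_eq_mul_div, div_le_iff₀ (by positivity)]
  refine (sq_le_sq₀ (by positivity) (by positivity)).1 ?_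
  calc (D * ‖g‖) ^ 2 = D * (D * ‖g‖ ^ 2) := by ring
    _ ≤ K * (D * ‖g‖ ^ 2) := by gcongr
    _ ≤ K * (9 * (s ^ 2 * K)) := by
        refine mul_le_mul_of_nonneg_left ?_ hK0
        have : 0 ≤ D * ‖g‖ ^ 2 := by positivity
        linarith
    _ = (s * (3 * K)) ^ 2 := by ring
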